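/- arXiv:1003.5060 — 3 statements merged into one kernel-verified Lean document; each statement's English description precedes it below -/
import Mathlib

section
/- Let G₁ and G₂ be finite abelian groups, G = G₁ × G₂, and 1 ≤ k ≤ |G|. Then θ(k, G) = min{ θ(k₁, G₁) · θ(k₂, G₂) : k₁ k₂ ≤ k, 1 ≤ k₁ ≤ |G₁|, 1 ≤ k₂ ≤ |G₂| }. -/
open Function

/-- The Fourier transform of `f : G → ℂ` on a finite abelian group `G`, as a function on the
dual group of characters: `f̂(χ) = ∑ x, f x * χ(-x)`. -/
noncomputable def dft (G : Type*) [AddCommGroup G] [Fintype G] (f : G → ℂ) :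
    AddChar G ℂ → ℂ :=
  fun χ => ∑ x : G, f x * χ (-x)

/-- Meshulam's function `θ(k, G)`: the minimal size of the spectrum of a nonzero function
on `G` whose support has size at most `k`. -/
noncomputable def theta (G : Type*) [AddCommGroup G] [Fintype G] (k : ℕ) : ℕ :=
  sInf {l | ∃ f : G → ℂ, f ≠ 0 ∧ (support f).ncard ≤ k ∧ (support (dft G f)).ncard = l}

namespace AddChar

variable {A B R : Type*} [AddCommGroup A] [AddCommGroup B] [CommMonoid R]

/-- The character `(x, y) ↦ χ x * ψ y` of a product group. -/
def prodMul (χ : AddChar A R) (ψ : AddChar B R) : AddChar (A × B) R :=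
  χ.compAddMonoidHom (AddMonoidHom.fst A B) * ψ.compAddMonoidHom (AddMonoidHom.snd A B)

@[simp]
theorem prodMul_apply (χ : AddChar A R) (ψ : AddChar B R) (z : A × B) :
    prodMul χ ψ z = χ z.1 * ψ z.2 := rfl

theorem prodMul_comp_inl (χ : AddChar A R) (ψ : AddChar B R) :
    (prodMul χ ψ).compAddMonoidHom (AddMonoidHom.inl A B) = χ := by
  ext x
  simp

theorem prodMul_comp_inr (χ : AddChar A R) (ψ : AddChar B R) :
    (prodMul χ ψ).compAddMonoidHom (AddMonoidHom.inr A B) = ψ := by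
  ext y
  simp

theorem prodMul_comp_inl_comp_inr (φ : AddChar (A × B) R) :
    prodMul (φ.compAddMonoidHom (AddMonoidHom.inl A B))
      (φ.compAddMonoidHom (AddMonoidHom.inr A B)) = φ := by
  ext z
  simp [← AddChar.map_add_eq_mul]

end AddChar

theorem Set.ncard_mul_le_ncard_of_fibers {α β : Type*} [Finite α] [Finite β] (S : Set α)
    (T : Set β) (p : α → β) (a : ℕ) (h : ∀ y ∈ T, a ≤ (S ∩ p ⁻¹' {y}).ncard) :
    T.ncard * a ≤ S.ncard := by
  classical
  have := Fintype.ofFinite α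
  have := Fintype.ofFinite β
  have hST : (T.toFinset.card) * a ≤ (S.toFinset.filter (p · ∈ T)).card := by
    rw [Finset.card_eq_sum_card_fiberwise (f := p) (t := T.toFinset) (by intro; simp),
      ← smul_eq_mul]
    refine Finset.card_nsmul_le_sum _ _ _ fun y hy => ?_
    rw [Set.mem_toFinset] at hy
    refine (h y hy).trans (le_of_eq ?_)
    rw [Set.ncard_eq_toFinset_card']
    congr 1
    ext x
    simp only [Set.mem_toFinset, Set.mem_inter_iff, Set.mem_preimage, Set.mem_singleton_iff,
      Finset.mem_filter]
    grind
  rw [Set.ncard_eq_toFinset_card', Set.ncard_eq_toFinset_card']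
  exact hST.trans (Finset.card_filter_le _ _)

section Theta

variable {G₁ G₂ : Type*} [AddCommGroup G₁] [Fintype G₁] [AddCommGroup G₂] [Fintype G₂]

theorem dft_prodMul (f : G₁ × G₂ → ℂ) (χ : AddChar G₁ ℂ) (ψ : AddChar G₂ ℂ) :
    dft (G₁ × G₂) f (AddChar.prodMul χ ψ) =
      dft G₁ (fun x => dft G₂ (fun y => f (x, y)) ψ) χ := by
  simp only [dft, Fintype.sum_prod_type, Finset.sum_mul]
  refine Fintype.sum_congr _ _ fun x => Fintype.sum_congr _ _ fun y => ?_
  simp only [AddChar.prodMul_apply, Prod.fst_neg, Prod.snd_neg]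
  ring

theorem dft_tensor_prodMul (f₁ : G₁ → ℂ) (f₂ : G₂ → ℂ) (χ : AddChar G₁ ℂ) (ψ : AddChar G₂ ℂ) :
    dft (G₁ × G₂) (fun z => f₁ z.1 * f₂ z.2) (AddChar.prodMul χ ψ) =
      dft G₁ f₁ χ * dft G₂ f₂ ψ := by
  rw [dft_prodMul]
  simp only [dft, Finset.sum_mul_sum]
  simp only [Finset.sum_mul]
  refine Fintype.sum_congr _ _ fun x => Fintype.sum_congr _ _ fun y => ?_
  ring

theorem theta_le {f : G₁ → ℂ} (hf : f ≠ 0) {k : ℕ} (hk : (support f).ncard ≤ k) :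
    theta G₁ k ≤ (support (dft G₁ f)).ncard :=
  Nat.sInf_le ⟨f, hf, hk, rfl⟩

variable (G₁) in
theorem exists_ncard_support_dft_eq_theta {k : ℕ} (hk : 1 ≤ k) :
    ∃ f : G₁ → ℂ, f ≠ 0 ∧ (support f).ncard ≤ k ∧ (support (dft G₁ f)).ncard = theta G₁ k := by
  classical
  refine Nat.sInf_mem (s := {l | ∃ f : G₁ → ℂ, f ≠ 0 ∧ (support f).ncard ≤ k ∧
    (support (dft G₁ f)).ncard = l}) ⟨_, Pi.single 0 1, by simp, ?_, rfl⟩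
  refine le_trans ?_ hk
  rw [← Set.ncard_singleton (0 : G₁)]
  exact Set.ncard_le_ncard Pi.support_single_subset

theorem theta_prod_le {k k₁ k₂ : ℕ} (h₁ : 1 ≤ k₁) (h₂ : 1 ≤ k₂) (hk : k₁ * k₂ ≤ k) :
    theta (G₁ × G₂) k ≤ theta G₁ k₁ * theta G₂ k₂ := by
  obtain ⟨f₁, hf₁, hs₁, ht₁⟩ := exists_ncard_support_dft_eq_theta G₁ h₁
  obtain ⟨f₂, hf₂, hs₂, ht₂⟩ := exists_ncard_support_dft_eq_theta G₂ h₂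
  obtain ⟨x, hx⟩ := Function.ne_iff.mp hf₁
  obtain ⟨y, hy⟩ := Function.ne_iff.mp hf₂
  have hf : (fun z : G₁ × G₂ => f₁ z.1 * f₂ z.2) ≠ 0 :=
    Function.ne_iff.mpr ⟨(x, y), mul_ne_zero hx hy⟩
  have hsupp : support (fun z : G₁ × G₂ => f₁ z.1 * f₂ z.2) = support f₁ ×ˢ support f₂ := by
    ext z
    simp
  refine (theta_le hf ?_).trans ?_
  · rw [hsupp, Set.ncard_prod]
    exact (Nat.mul_le_mul hs₁ hs₂).trans hk
  · rw [← ht₁, ← ht₂, ← Set.ncard_prod]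
    have hsub : support (dft (G₁ × G₂) fun z => f₁ z.1 * f₂ z.2) ⊆
        (fun c : AddChar G₁ ℂ × AddChar G₂ ℂ => AddChar.prodMul c.1 c.2) ''
          (support (dft G₁ f₁) ×ˢ support (dft G₂ f₂)) := by
      intro φ hφ
      rw [mem_support, ← AddChar.prodMul_comp_inl_comp_inr φ, dft_tensor_prodMul] at hφ
      exact ⟨(_, _), ⟨left_ne_zero_of_mul hφ, right_ne_zero_of_mul hφ⟩,
        AddChar.prodMul_comp_inl_comp_inr φ⟩
    exact (Set.ncard_le_ncard hsub).trans (Set.ncard_image_le)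

theorem exists_theta_mul_theta_le (f : G₁ × G₂ → ℂ) (hf : f ≠ 0) :
    ∃ k₁ k₂ : ℕ, 1 ≤ k₁ ∧ k₁ ≤ Fintype.card G₁ ∧ 1 ≤ k₂ ∧ k₂ ≤ Fintype.card G₂ ∧
      k₁ * k₂ ≤ (support f).ncard ∧
      theta G₁ k₁ * theta G₂ k₂ ≤ (support (dft (G₁ × G₂) f)).ncard := by
  let X : Set G₁ := {x | (fun y => f (x, y)) ≠ 0}
  have hX : X.Nonempty := by
    obtain ⟨⟨x, y⟩, hxy⟩ := Function.ne_iff.mp hf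
    exact ⟨x, Function.ne_iff.mpr ⟨y, hxy⟩⟩
  obtain ⟨x₀, hx₀, hmin⟩ :=
    Set.exists_min_image X (fun x => (support fun y => f (x, y)).ncard) X.toFinite hX
  refine ⟨X.ncard, (support fun y => f (x₀, y)).ncard, (Set.ncard_pos).mpr hX, ?_,
    (Set.ncard_pos).mpr (support_nonempty_iff.mpr hx₀), ?_, ?_, ?_⟩
  · exact Nat.card_eq_fintype_card (α := G₁) ▸ Set.ncard_le_card X
  · exact Nat.card_eq_fintype_card (α := G₂) ▸ Set.ncard_le_card _
  · refine Set.ncard_mul_le_ncard_of_fibers _ _ Prod.fst _ fun x hx => (hmin x hx).trans ?_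
    rw [← Set.ncard_image_of_injective _ (Prod.mk_right_injective x)]
    refine Set.ncard_le_ncard ?_
    rintro _ ⟨y, hy, rfl⟩
    exact ⟨hy, rfl⟩
  · rw [mul_comm]
    refine (Nat.mul_le_mul_right _ (theta_le hx₀ le_rfl)).trans ?_
    refine Set.ncard_mul_le_ncard_of_fibers _ _
      (fun φ => φ.compAddMonoidHom (AddMonoidHom.inr G₁ G₂)) _ fun ψ hψ => ?_
    have hF : (fun x => dft G₂ (fun y => f (x, y)) ψ) ≠ 0 := Function.ne_iff.mpr ⟨x₀, hψ⟩
    have hFX : support (fun x => dft G₂ (fun y => f (x, y)) ψ) ⊆ X := by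
      intro x hx h0
      exact hx (by simp [dft, fun y => congrFun h0 y])
    refine (theta_le hF (Set.ncard_le_ncard hFX)).trans ?_
    have hinj : Injective fun χ : AddChar G₁ ℂ => AddChar.prodMul χ ψ :=
      LeftInverse.injective (g := fun φ => φ.compAddMonoidHom (AddMonoidHom.inl G₁ G₂))
        fun χ => AddChar.prodMul_comp_inl χ ψ
    rw [← Set.ncard_image_of_injective _ hinj]
    refine Set.ncard_le_ncard ?_
    rintro _ ⟨χ, hχ, rfl⟩
    refine ⟨?_, AddChar.prodMul_comp_inr χ ψ⟩
    rwa [mem_support, dft_prodMul]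

end Theta

/-- For `G = G₁ × G₂`,
`θ(k, G) = min { θ(k₁, G₁) · θ(k₂, G₂) : k₁ k₂ ≤ k, 1 ≤ kᵢ ≤ |Gᵢ| }`. -/
theorem theta_prod (G₁ G₂ : Type*) [AddCommGroup G₁] [Fintype G₁]
    [AddCommGroup G₂] [Fintype G₂] (k : ℕ)
    (hk1 : 1 ≤ k) (hk2 : k ≤ Fintype.card (G₁ × G₂)) :
    theta (G₁ × G₂) k =
      sInf {m | ∃ k₁ k₂ : ℕ, 1 ≤ k₁ ∧ k₁ ≤ Fintype.card G₁ ∧ 1 ≤ k₂ ∧ k₂ ≤ Fintype.card G₂ ∧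
        k₁ * k₂ ≤ k ∧ m = theta G₁ k₁ * theta G₂ k₂} := by
  obtain ⟨f, hf, hs, ht⟩ := exists_ncard_support_dft_eq_theta (G₁ × G₂) hk1
  obtain ⟨k₁, k₂, h₁, h₁', h₂, h₂', hk, hle⟩ := exists_theta_mul_theta_le f hf
  have hmem : theta G₁ k₁ * theta G₂ k₂ ∈
      {m | ∃ k₁ k₂ : ℕ, 1 ≤ k₁ ∧ k₁ ≤ Fintype.card G₁ ∧ 1 ≤ k₂ ∧ k₂ ≤ Fintype.card G₂ ∧
        k₁ * k₂ ≤ k ∧ m = theta G₁ k₁ * theta G₂ k₂} :=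
    ⟨k₁, k₂, h₁, h₁', h₂, h₂', hk.trans hs, rfl⟩
  refine le_antisymm (le_csInf ⟨_, hmem⟩ ?_) ((Nat.sInf_le hmem).trans (hle.trans_eq ht))
  rintro _ ⟨l₁, l₂, hl₁, -, hl₂, -, hl, rfl⟩
  exact theta_prod_le hl₁ hl₂ hl
end

section
/- Let p and q be prime numbers with 1 < q < p, G = ℤ/qℤ × ℤ/pℤ, and q(p+1)/(q+1) < k ≤ p. Then every equality case for (k, G) is of the form (x, y) ↦ δ_b(x) f(y), where b ∈ ℤ/qℤ, δ_b is the indicator function of {b}, and f : ℤ/pℤ → ℂ satisfies |supp(f)| = k and |supp(f̂)| = p - k + 1. -/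
open Function

/-- An equality case for `(k, G)`: a nonzero function with support of size exactly `k`
and spectrum of minimal size `θ(k, G)`. -/
def IsEqualityCase (G : Type*) [AddCommGroup G] [Fintype G] (k : ℕ) (f : G → ℂ) : Prop :=
  f ≠ 0 ∧ (support f).ncard = k ∧ (support (dft G f)).ncard = theta G k

/-- The Fourier transform on `ℤ/nℤ`: `f̂(y) = ∑ x, f x * e^{-2πi x y / n}`. -/
noncomputable def zdft (n : ℕ) [NeZero n] (f : ZMod n → ℂ) : ZMod n → ℂ :=
  fun y => ∑ x : ZMod n,
    f x * Complex.exp (-2 * Real.pi * Complex.I * ((x.val * y.val : ℕ) : ℂ) / (n : ℂ))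

open Polynomial in
/-- A polynomial supported on a set `S` of exponents that stay distinct in the coefficient domain
and vanishing at `1` to order at least `S.card` is zero. -/
theorem Polynomial.eq_zero_of_X_sub_one_pow_card_dvd {A : Type*} [CommRing A] [IsDomain A]
    (S : Finset ℕ) (hS : Set.InjOn (Nat.cast : ℕ → A) S) (P : A[X]) (hPS : P.support ⊆ S)
    (hP : (X - 1) ^ S.card ∣ P) : P = 0 := by
  induction S using Finset.induction_on generalizing P with
  | empty => simpa using hPS
  | insert a S ha ih =>
    rw [Finset.card_insert_of_notMem ha] at hP
    have hcoeff : ∀ n : ℕ, (X * derivative P - C (a : A) * P).coeff n = ((n : A) - a) * P.coeff n := by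
      rintro (_ | n)
      · simp
      · simp only [coeff_sub, coeff_X_mul, coeff_derivative, coeff_C_mul]
        push_cast
        ring
    have hQ : X * derivative P - C (a : A) * P = 0 := by
      refine ih (hS.mono (by simp)) _ (fun n hn => ?_) ?_
      · rw [mem_support_iff, hcoeff] at hn
        have hnS := hPS (mem_support_iff.2 (right_ne_zero_of_mul hn))
        rcases Finset.mem_insert.1 hnS with rfl | h
        · simp at hn
        · exact h
      · refine dvd_sub ((?_ : _ ∣ derivative P).mul_left X)
          (((pow_dvd_pow _ (Nat.le_succ _)).trans hP).mul_left _)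
        simpa using pow_sub_one_dvd_derivative_of_pow_dvd hP
    have hmono : P = C (P.coeff a) * X ^ a := by
      ext n
      rw [coeff_C_mul_X_pow]
      split_ifs with h
      · rw [h]
      · by_contra hn
        have hnS := hPS (mem_support_iff.2 hn)
        have h0 := hcoeff n
        rw [hQ, coeff_zero, eq_comm, mul_eq_zero, or_iff_left hn, sub_eq_zero] at h0
        exact h (hS hnS (by simp) h0)
    have hroot : P.eval 1 = 0 := by
      have h1 := (dvd_pow_self (X - 1 : A[X]) (Nat.succ_ne_zero _)).trans hP
      rw [← C_1] at h1
      exact dvd_iff_isRoot.1 h1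
    rw [hmono] at hroot
    rw [hmono, show P.coeff a = 0 by simpa using hroot, C_0, zero_mul]

open Polynomial in
/-- Chebotarev's theorem in a domain with a prime `π` dividing `p`: a generalized Vandermonde
matrix `z i ^ a j`, with distinct nodes congruent to `1` modulo `π` and distinct exponents less
than `p`, has trivial kernel. -/
theorem eq_zero_of_sum_mul_pow_eq_zero {R : Type*} [CommRing R] [IsDomain R] [WfDvdMonoid R]
    {π : R} (hπ : Prime π) {p : ℕ} [Fact p.Prime] (hp : π ∣ p) {ι : Type*} [Fintype ι]
    {a : ι → ℕ} (ha : Injective a) (hap : ∀ i, a i < p) {z : ι → R} (hz : Injective z)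
    (hz1 : ∀ i, π ∣ z i - 1) (v : ι → R) (hv : ∀ i, ∑ j, v j * z i ^ a j = 0) : v = 0 := by
  classical
  have : (Ideal.span {π}).IsPrime := (Ideal.span_singleton_prime hπ.ne_zero).2 hπ
  let φ : R →+* R ⧸ Ideal.span {π} := Ideal.Quotient.mk _
  have hφ : ∀ x, φ x = 0 ↔ π ∣ x := fun x => by
    rw [Ideal.Quotient.eq_zero_iff_mem, Ideal.mem_span_singleton]
  have : CharP (R ⧸ Ideal.span {π}) p := by
    refine (CharP.charP_iff_prime_eq_zero Fact.out).2 ?_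
    rw [← map_natCast φ, hφ]
    exact hp
  have key : ∀ v : ι → R, (∀ i, ∑ j, v j * z i ^ a j = 0) → ∀ j, π ∣ v j := by
    intro v hv
    let P : R[X] := ∑ j, C (v j) * X ^ a j
    have hcoeff : ∀ j, P.coeff (a j) = v j := fun j => by
      simp [P, coeff_X_pow, ha.eq_iff]
    have hdvd : ∏ i, (X - C (z i)) ∣ P := by
      rcases eq_or_ne P 0 with h0 | h0
      · simp [h0]
      have h := (Multiset.prod_X_sub_C_dvd_iff_le_roots h0 (Finset.univ.val.map z)).2 <|
        (Multiset.le_iff_subset (Finset.univ.nodup.map hz)).2 fun x hx => by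
          obtain ⟨i, -, rfl⟩ := Multiset.mem_map.1 hx
          rw [mem_roots h0, IsRoot, eval_finsetSum]
          simpa using hv i
      rwa [Multiset.map_map] at h
    have hmap : P.map φ = 0 := by
      refine eq_zero_of_X_sub_one_pow_card_dvd (Finset.univ.image a) ?_ _ ?_ ?_
      · refine (CharP.natCast_injOn_Iio _ p).mono fun n hn => ?_
        obtain ⟨i, -, rfl⟩ := Finset.mem_image.1 (Finset.mem_coe.1 hn)
        exact hap i
      · intro n hn
        by_contra hna
        refine mem_support_iff.1 hn ?_
        rw [coeff_map, finsetSum_coeff, Finset.sum_eq_zero, map_zero]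
        intro j _
        rw [coeff_C_mul_X_pow, if_neg]
        rintro rfl
        exact hna (Finset.mem_image_of_mem _ (Finset.mem_univ _))
      · have h := Polynomial.map_dvd φ hdvd
        have hz' : ∀ i, φ (z i) = 1 := fun i => by
          rw [← sub_eq_zero, ← map_one φ, ← map_sub, hφ]
          exact hz1 i
        simpa [Polynomial.map_prod, hz', Finset.card_image_of_injective _ ha] using h
    intro j
    rw [← hφ, ← hcoeff, ← coeff_map, hmap, coeff_zero]
  have hpow : ∀ n : ℕ, ∀ v : ι → R, (∀ i, ∑ j, v j * z i ^ a j = 0) → ∀ j, π ^ n ∣ v j := by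
    intro n
    induction n with
    | zero => simp
    | succ n ih =>
      intro v hv j
      choose w hw using key v hv
      rw [hw j, pow_succ']
      refine mul_dvd_mul_left π (ih w (fun i => ?_) j)
      have h := hv i
      simp only [hw, mul_assoc, ← Finset.mul_sum] at h
      exact (mul_eq_zero.1 h).resolve_left hπ.ne_zero
  funext j
  by_contra hj
  obtain ⟨n, hn⟩ := FiniteMultiplicity.of_not_isUnit hπ.not_isUnit hj
  exact hn (hpow _ v hv j)

/-- Chebotarev's theorem on roots of unity: every minor of the Fourier matrix of prime order `p`
is nonsingular. -/
theorem eq_zero_of_sum_mul_rootOfUnity_pow_eq_zero {p : ℕ} [Fact p.Prime] {ι : Type*} [Fintype ι]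
    {a : ι → ℕ} (ha : Injective a) (hap : ∀ i, a i < p) {z : ι → ℂ} (hz : Injective z)
    (hzp : ∀ i, z i ^ p = 1) (v : ι → ℂ) (hv : ∀ i, ∑ j, v j * z i ^ a j = 0) : v = 0 := by
  classical
  have : NeZero (p : ℚ) := ⟨Nat.cast_ne_zero.2 (Fact.out : p.Prime).ne_zero⟩
  let K := CyclotomicField p ℚ
  have : IsCyclotomicExtension {p} ℚ K := CyclotomicField.isCyclotomicExtension p ℚ
  let R := NumberField.RingOfIntegers K
  have hζ : IsPrimitiveRoot (IsCyclotomicExtension.zeta p ℚ K) p :=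
    IsCyclotomicExtension.zeta_spec p ℚ K
  let ζ : R := hζ.toInteger
  have hζR : IsPrimitiveRoot ζ p := hζ.toInteger_isPrimitiveRoot
  have hπ : Prime (ζ - 1) := hζ.zeta_sub_one_prime'
  have hp : ζ - 1 ∣ (p : R) := by
    have h := Polynomial.sub_dvd_eval_sub ζ 1 (Polynomial.cyclotomic p R)
    rwa [Polynomial.eval_one_cyclotomic_prime,
      (hζR.isRoot_cyclotomic (Fact.out : p.Prime).pos).eq_zero, zero_sub, dvd_neg] at h
  let φ : R →+* ℂ := (Classical.arbitrary (K →+* ℂ)).comp (algebraMap R K)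
  have hφ : Injective φ :=
    (Classical.arbitrary (K →+* ℂ)).injective.comp (FaithfulSMul.algebraMap_injective R K)
  have hζC : IsPrimitiveRoot (φ ζ) p := hζR.map_of_injective hφ
  choose e _ he using fun i => hζC.eq_pow_of_pow_eq_one (hzp i)
  let M : Matrix ι ι R := Matrix.of fun i j => (ζ ^ e i) ^ a j
  have hφM : ∀ i j, φ (M i j) = z i ^ a j := fun i j => by simp [M, he]
  by_contra hv0
  have hdet : (φ.mapMatrix M).det = 0 := by
    refine Matrix.exists_mulVec_eq_zero_iff.1 ⟨v, hv0, funext fun i => ?_⟩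
    simpa [Matrix.mulVec, dotProduct, hφM, mul_comm] using hv i
  rw [← RingHom.map_det, map_eq_zero_iff φ hφ] at hdet
  obtain ⟨w, hw0, hw⟩ := Matrix.exists_mulVec_eq_zero_iff.2 hdet
  refine hw0 (eq_zero_of_sum_mul_pow_eq_zero hπ hp ha hap (z := fun i => ζ ^ e i) ?_ ?_ w ?_)
  · intro i j hij
    refine hz ?_
    rw [← he i, ← he j, ← map_pow, ← map_pow]
    exact congrArg φ hij
  · exact fun i => by simpa using sub_dvd_pow_sub_pow ζ 1 (e i)
  · intro i
    simpa [Matrix.mulVec, dotProduct, M, mul_comm] using congrFun hw i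

/-- A character of a product of groups is the same as a pair of characters of the factors. -/
noncomputable def AddChar.prodEquiv (A B : Type*) [AddCommGroup A] [AddCommGroup B] :
    AddChar (A × B) ℂ ≃ AddChar A ℂ × AddChar B ℂ where
  toFun χ := (χ.compAddMonoidHom (AddMonoidHom.inl A B), χ.compAddMonoidHom (AddMonoidHom.inr A B))
  invFun ψ := ψ.1.compAddMonoidHom (AddMonoidHom.fst A B) *
    ψ.2.compAddMonoidHom (AddMonoidHom.snd A B)
  left_inv χ := by
    ext x
    simp [← AddChar.map_add_eq_mul]
  right_inv ψ := by
    ext <;> simp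

theorem AddChar.ncard_add_ncard_compl {G : Type*} [AddCommGroup G] [Fintype G]
    (s : Set (AddChar G ℂ)) : s.ncard + sᶜ.ncard = Fintype.card G := by
  rw [Set.ncard_add_ncard_compl, Nat.card_eq_fintype_card, AddChar.card_eq]

theorem dft_prod {A B : Type*} [AddCommGroup A] [Fintype A] [AddCommGroup B] [Fintype B]
    (F : A × B → ℂ) (χ : AddChar (A × B) ℂ) :
    dft (A × B) F χ = dft A (fun a => dft B (fun b => F (a, b)) (AddChar.prodEquiv A B χ).2)
      (AddChar.prodEquiv A B χ).1 := by
  simp only [dft, Fintype.sum_prod_type, Finset.sum_mul]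
  refine Finset.sum_congr rfl fun a _ => Finset.sum_congr rfl fun b _ => ?_
  rw [mul_assoc]
  congr 1
  simp [AddChar.prodEquiv, ← AddChar.map_add_eq_mul]

theorem dft_zero {G : Type*} [AddCommGroup G] [Fintype G] : dft G 0 = 0 := by
  funext χ
  simp [dft]

/-- The uncertainty principle for groups of prime order. -/
theorem prime_add_one_le_ncard_support_add_ncard_support_dft {p : ℕ} [Fact p.Prime]
    {f : ZMod p → ℂ} (hf : f ≠ 0) :
    p + 1 ≤ (support f).ncard + (support (dft (ZMod p) f)).ncard := by
  classical
  by_contra! hlt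
  have hcard := AddChar.ncard_add_ncard_compl (support (dft (ZMod p) f))
  rw [ZMod.card] at hcard
  have hle : Fintype.card (support f) ≤ Fintype.card ↥(support (dft (ZMod p) f))ᶜ := by
    rw [← Nat.card_eq_fintype_card, ← Nat.card_eq_fintype_card, Nat.card_coe_set_eq,
      Nat.card_coe_set_eq]
    omega
  obtain ⟨e⟩ := Function.Embedding.nonempty_of_card_le hle
  have hpow : ∀ (χ : AddChar (ZMod p) ℂ) (x : ZMod p), χ (-x) = χ (-1) ^ x.val := fun χ x => by
    rw [← AddChar.map_nsmul_eq_pow]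
    simp
  have h := eq_zero_of_sum_mul_rootOfUnity_pow_eq_zero (p := p) (ι := support f)
    (a := fun x => (x : ZMod p).val) (z := fun x => (e x : AddChar (ZMod p) ℂ) (-1))
    ((ZMod.val_injective p).comp Subtype.val_injective) (fun x => ZMod.val_lt _) ?_ ?_
    (fun x => f x) ?_
  · obtain ⟨x, hx⟩ := Function.ne_iff.1 hf
    exact hx (congrFun h ⟨x, hx⟩)
  · intro i j hij
    refine e.injective (Subtype.ext (DFunLike.ext _ _ fun x => ?_))
    rw [← neg_neg x, hpow, hpow _ (-x)]
    exact congrArg (fun c => c ^ (-x).val) hij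
  · intro i
    rw [← AddChar.map_nsmul_eq_pow]
    simp
  · intro i
    have hi : dft (ZMod p) f (e i) = 0 := not_not.1 (e i).2
    simp_rw [← hpow]
    rw [← hi, dft, ← Finset.sum_subset (Finset.subset_univ (support f).toFinset),
      Finset.sum_subtype (p := (· ∈ support f)) _ (fun x => Set.mem_toFinset)]
    intro x _ hx
    rw [Set.mem_toFinset, notMem_support] at hx
    rw [hx, zero_mul]

/-- On any finite abelian group, a nonzero function supported on `k` points can be chosen with
spectrum avoiding `k - 1` given characters. -/
theorem exists_ncard_support_le_and_ncard_support_dft_le {G : Type*} [AddCommGroup G] [Fintype G]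
    {k : ℕ} (hk0 : 0 < k) (hk : k ≤ Fintype.card G) :
    ∃ f : G → ℂ, f ≠ 0 ∧ (support f).ncard ≤ k ∧
      (support (dft G f)).ncard ≤ Fintype.card G - k + 1 := by
  classical
  obtain ⟨S, -, hS⟩ := Finset.exists_subset_card_eq (s := (Finset.univ : Finset G)) (n := k)
    (by simpa using hk)
  obtain ⟨T, -, hT⟩ := Finset.exists_subset_card_eq
    (s := (Finset.univ : Finset (AddChar G ℂ))) (n := k - 1)
    (by rw [Finset.card_univ, AddChar.card_eq]; omega)
  let L : (S → ℂ) →ₗ[ℂ] (T → ℂ) :=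
    (Matrix.of fun (χ : T) (x : S) => (χ : AddChar G ℂ) (-x)).mulVecLin
  obtain ⟨v, hv, hv0⟩ := (LinearMap.ker L).ne_bot_iff.1
    (LinearMap.ker_ne_bot_of_finrank_lt (f := L) (by simp [hS, hT]; omega))
  let f : G → ℂ := fun x => if h : x ∈ S then v ⟨x, h⟩ else 0
  have hfS : support f ⊆ S := fun x hx => by
    by_contra h
    exact hx (dif_neg h)
  refine ⟨f, fun h => hv0 (funext fun x => ?_), ?_, ?_⟩
  · simpa [f] using congrFun h x
  · simpa [hS] using Set.ncard_le_ncard hfS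
  · have hsub : support (dft G f) ⊆ (T : Set (AddChar G ℂ))ᶜ := by
      intro χ hχ hχT
      refine hχ ?_
      have h := congrFun (LinearMap.mem_ker.1 hv) ⟨χ, hχT⟩
      simp only [L, Matrix.mulVecLin_apply, Matrix.mulVec, dotProduct, Matrix.of_apply,
        Pi.zero_apply] at h
      rw [dft, ← h, ← Finset.sum_subset (Finset.subset_univ S), ← Finset.sum_coe_sort S]
      · refine Finset.sum_congr rfl fun x _ => ?_
        simp [f, mul_comm]
      · intro x _ hx
        simp [f, hx]
    have h1 := Set.ncard_le_ncard hsub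
    have h2 := AddChar.ncard_add_ncard_compl (T : Set (AddChar G ℂ))
    rw [Set.ncard_coe_finset] at h2
    omega

/-- The upper bound on Meshulam's function of a product given by functions supported on a single
coset of the second factor. -/
theorem theta_prod_le_s12 {A B : Type*} [AddCommGroup A] [Fintype A] [AddCommGroup B] [Fintype B]
    {k : ℕ} (hk0 : 0 < k) (hk : k ≤ Fintype.card B) :
    theta (A × B) k ≤ Fintype.card A * (Fintype.card B - k + 1) := by
  classical
  obtain ⟨f, hf0, hfk, hfd⟩ := exists_ncard_support_le_and_ncard_support_dft_le hk0 hk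
  let F : A × B → ℂ := fun x => if x.1 = 0 then f x.2 else 0
  have hF : support F ⊆ (fun b => ((0 : A), b)) '' support f := by
    rintro ⟨a, b⟩ h
    have : a = 0 ∧ f b ≠ 0 := by simpa [F] using h
    exact ⟨b, this.2, by rw [this.1]⟩
  have hdF : support (dft (A × B) F) ⊆
      AddChar.prodEquiv A B ⁻¹' (Set.univ ×ˢ support (dft B f)) := by
    intro χ hχ
    refine ⟨Set.mem_univ _, fun h => hχ ?_⟩
    rw [dft_prod]
    refine (congrFun (congrArg (dft A) (funext fun a => ?_)) _).trans (congrFun dft_zero _)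
    by_cases ha : a = 0
    · simpa [F, ha] using h
    · simp only [F, ha, if_false]
      exact congrFun dft_zero _
  calc theta (A × B) k ≤ (support (dft (A × B) F)).ncard := by
        refine Nat.sInf_le ⟨F, fun h => hf0 (funext fun b => ?_), ?_, rfl⟩
        · simpa [F] using congrFun h (0, b)
        · exact (Set.ncard_le_ncard hF).trans ((Set.ncard_image_le).trans hfk)
    _ ≤ _ := Set.ncard_le_ncard hdF
    _ = Fintype.card A * (support (dft B f)).ncard := by
        rw [Set.ncard_preimage_of_injective_subset_range (AddChar.prodEquiv A B).injective
          (by simp), Set.ncard_prod, Set.ncard_univ, Nat.card_eq_fintype_card, AddChar.card_eq]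
    _ ≤ _ := Nat.mul_le_mul_left _ hfd

/-- If `r` of the rows of `F` are nonzero then the spectrum of `F` is at least `q + 1 - r` times
that of each row. -/
theorem ncard_support_dft_row_mul_le {q : ℕ} [Fact q.Prime] {B : Type*} [AddCommGroup B]
    [Fintype B] (F : ZMod q × B → ℂ) (a : ZMod q) :
    (support (dft B fun b => F (a, b))).ncard *
      (q + 1 - {a | (fun b => F (a, b)) ≠ 0}.ncard) ≤ (support (dft (ZMod q × B) F)).ncard := by
  classical
  rw [Set.ncard_eq_toFinset_card', Set.ncard_eq_toFinset_card' (support (dft (ZMod q × B) F))]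
  refine le_trans ?_ (Finset.card_le_card (Finset.filter_subset
    (fun χ => (AddChar.prodEquiv (ZMod q) B χ).2 ∈ support (dft B fun b => F (a, b))) _))
  rw [Finset.card_eq_sum_card_fiberwise (f := fun χ => (AddChar.prodEquiv (ZMod q) B χ).2)
    (t := (support (dft B fun b => F (a, b))).toFinset) (fun χ hχ => by simpa using (Finset.mem_filter.1 hχ).2),
    ← smul_eq_mul]
  refine Finset.card_nsmul_le_sum _ _ _ fun ψ hψ => ?_
  have hψ' : dft B (fun b => F (a, b)) ψ ≠ 0 := by simpa using hψ
  let g : ZMod q → ℂ := fun a => dft B (fun b => F (a, b)) ψ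
  have hg := prime_add_one_le_ncard_support_add_ncard_support_dft (f := g)
    (fun h => hψ' (congrFun h a))
  have hsub : support g ⊆ {a | (fun b => F (a, b)) ≠ 0} := fun x hx h0 => by
    refine hx ?_
    change dft B (fun b => F (x, b)) ψ = 0
    rw [h0]
    exact congrFun dft_zero _
  have h1 := Set.ncard_le_ncard hsub
  refine le_trans (b := (support (dft (ZMod q) g)).ncard) (by omega) ?_
  rw [Set.ncard_eq_toFinset_card']
  refine Finset.card_le_card_of_injOn (fun χ => (AddChar.prodEquiv (ZMod q) B).symm (χ, ψ)) ?_
    fun χ _ χ' _ h => congrArg Prod.fst ((AddChar.prodEquiv (ZMod q) B).symm.injective h)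
  intro χ hχ
  have hχ' : dft (ZMod q) g χ ≠ 0 := by simpa using hχ
  simpa [dft_prod, hψ'] using hχ'

/-- The number of nonzero values is the sum over rows, so some nonzero row is below average. -/
theorem exists_ncard_mul_ncard_support_row_le {A B : Type*} [Finite A] [Finite B]
    {F : A × B → ℂ} (hF : F ≠ 0) :
    ∃ a, (fun b => F (a, b)) ≠ 0 ∧
      {a | (fun b => F (a, b)) ≠ 0}.ncard * (support fun b => F (a, b)).ncard ≤
        (support F).ncard := by
  classical
  have := Fintype.ofFinite A
  have := Fintype.ofFinite B
  set R : Set A := {a | (fun b => F (a, b)) ≠ 0}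
  obtain ⟨⟨a₀, b₀⟩, hab⟩ := Function.ne_iff.1 hF
  have hR : R.toFinset.Nonempty := ⟨a₀, by
    simpa [R] using fun h => hab (congrFun h b₀)⟩
  obtain ⟨a, ha, hmin⟩ := Finset.exists_min_image R.toFinset
    (fun a => (support fun b => F (a, b)).ncard) hR
  refine ⟨a, Set.mem_toFinset.1 ha, ?_⟩
  rw [Set.ncard_eq_toFinset_card' R, Set.ncard_eq_toFinset_card' (support F),
    Finset.card_eq_sum_card_fiberwise (f := Prod.fst) (t := R.toFinset), ← smul_eq_mul]
  · refine Finset.card_nsmul_le_sum _ _ _ fun x hx => (hmin x hx).trans ?_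
    rw [Set.ncard_eq_toFinset_card']
    refine Finset.card_le_card_of_injOn (fun b => (x, b)) (fun b hb => ?_)
      fun b _ b' _ h => congrArg Prod.snd h
    simpa using hb
  · rintro ⟨x, b⟩ hx
    have hx' : F (x, b) ≠ 0 := by simpa using hx
    simpa [R] using fun h => hx' (congrFun h b)

theorem zdft_eq_dft (n : ℕ) [NeZero n] (f : ZMod n → ℂ) (y : ZMod n) :
    zdft n f y = dft (ZMod n) f (AddChar.zmodAddEquiv y) := by
  refine Finset.sum_congr rfl fun x _ => ?_
  congr 1
  have h : AddChar.zmod n y (-x) = Circle.exp (2 * Real.pi * ((y.val : ℤ) * (-x.val : ℤ) / n)) := by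
    rw [← AddChar.zmod_intCast]
    simp
  rw [AddChar.zmodAddEquiv_apply]
  change _ = ((AddChar.zmod n y (-x) : Circle) : ℂ)
  rw [h, Circle.coe_exp]
  congr 1
  push_cast
  ring

theorem ncard_support_zdft (n : ℕ) [NeZero n] (f : ZMod n → ℂ) :
    (support (zdft n f)).ncard = (support (dft (ZMod n) f)).ncard := by
  have h : support (zdft n f) = AddChar.zmodAddEquiv ⁻¹' support (dft (ZMod n) f) := by
    ext y
    simp [zdft_eq_dft]
  rw [h, Set.ncard_preimage_of_injective_subset_range AddChar.zmodAddEquiv.injective]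
  simp [AddChar.zmodAddEquiv.surjective.range_eq]

/-- The inequality between the sizes `s`, `d` of the support and of the spectrum of a row that
excludes `r ≥ 2` nonzero rows. -/
theorem mul_add_le_of_row_bounds {q k N r s d : ℕ} (hr : 1 < r) (hrq : r ≤ q) (hs : r * s ≤ k)
    (hsd : k + N ≤ s + d) (hd : d * (q + 1 - r) ≤ q * N) : k * (q + 1) ≤ q * (k + N) := by
  obtain ⟨t, rfl⟩ : ∃ t, r = t + 2 := ⟨r - 2, by omega⟩
  obtain ⟨m, rfl⟩ : ∃ m, q = t + 2 + m := ⟨q - (t + 2), by omega⟩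
  rw [show t + 2 + m + 1 - (t + 2) = m + 1 by omega] at hd
  have h1 : (t + 2) * (k + N) ≤ k + (t + 2) * d := by nlinarith
  have h2 : (t + 1) * ((m + 1) * k) ≤ (t + 1) * ((t + 2) * N) := by
    nlinarith [Nat.mul_le_mul_left (m + 1) h1, Nat.mul_le_mul_left (t + 2) hd]
  have h3 := Nat.le_of_mul_le_mul_left h2 (Nat.succ_pos t)
  nlinarith [Nat.zero_le (m * k), Nat.zero_le (m * N)]

/-- For `G = ℤ/qℤ × ℤ/pℤ`, `q < p` primes and `q(p+1)/(q+1) < k ≤ p` (the strict lower bound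
written as `q(p+1) < k(q+1)`), every equality case for `(k, G)` is of the form
`(x, y) ↦ δ_b(x) f(y)` with `|supp f| = k` and `|supp f̂| = p - k + 1`. -/
theorem equality_case_large_k (p q : ℕ) [Fact p.Prime] [Fact q.Prime] (hqp : q < p)
    (k : ℕ) (hk1 : q * (p + 1) < k * (q + 1)) (hk2 : k ≤ p)
    (F : ZMod q × ZMod p → ℂ) (hF : IsEqualityCase (ZMod q × ZMod p) k F) :
    ∃ (b : ZMod q) (f : ZMod p → ℂ),
      (support f).ncard = k ∧ (support (zdft p f)).ncard = p - k + 1 ∧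
      F = fun x => (if x.1 = b then 1 else 0) * f x.2 := by
  obtain ⟨hF0, hFk, hFd⟩ := hF
  have hk0 : 0 < k := Nat.pos_of_ne_zero (by rintro rfl; simp at hk1)
  have hq0 : 0 < q := (Fact.out : q.Prime).pos
  have hθ := theta_prod_le_s12 (A := ZMod q) (B := ZMod p) hk0 (by simpa using hk2)
  rw [ZMod.card, ZMod.card, ← hFd] at hθ
  obtain ⟨a, ha, hak⟩ := exists_ncard_mul_ncard_support_row_le hF0
  have hrow := (ncard_support_dft_row_mul_le F a).trans hθ
  have hunc := prime_add_one_le_ncard_support_add_ncard_support_dft ha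
  set R : Set (ZMod q) := {a | (fun b => F (a, b)) ≠ 0}
  have hRq : R.ncard ≤ q := by
    simpa using Set.ncard_le_ncard (Set.subset_univ R)
  have hR0 : 0 < R.ncard := (Set.ncard_pos).2 ⟨a, ha⟩
  have hR1 : R.ncard = 1 := by
    rw [hFk] at hak
    refine Nat.le_antisymm (not_lt.1 fun h1 => ?_) hR0
    rw [show p + 1 = k + (p - k + 1) by omega] at hk1 hunc
    exact not_le_of_gt hk1 (mul_add_le_of_row_bounds h1 hRq hak hunc hrow)
  obtain ⟨b, hb⟩ := Set.ncard_eq_one.1 hR1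
  obtain rfl : a = b := by
    have : a ∈ R := ha
    simpa [hb] using this
  have hFa : ∀ x y, x ≠ a → F (x, y) = 0 := fun x y hx => by
    have hxR : x ∉ R := by simpa [hb] using hx
    exact congrFun (not_not.1 hxR) y
  have hsupp : (support fun y => F (a, y)).ncard = k := by
    rw [← hFk, ← Set.ncard_image_of_injective _ (Prod.mk_right_injective a)]
    congr 1
    ext ⟨x, y⟩
    simp only [Set.mem_image, mem_support, Prod.mk.injEq]
    constructor
    · rintro ⟨_, h, rfl, rfl⟩
      exact h
    · intro h
      obtain rfl : x = a := by_contra fun hx => h (hFa x y hx)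
      exact ⟨y, h, rfl, rfl⟩
  refine ⟨a, fun y => F (a, y), hsupp, ?_, ?_⟩
  · rw [ncard_support_zdft]
    rw [hR1, Nat.add_sub_cancel, mul_comm] at hrow
    have := Nat.le_of_mul_le_mul_left hrow hq0
    omega
  · funext ⟨x, y⟩
    by_cases hx : x = a
    · simp [hx]
    · simp [hx, hFa x y hx]
end

section
/- Let p and q be prime numbers with 1 < q < p such that r = (p+1)/(q+1) is an integer, let G = ℤ/qℤ × ℤ/pℤ and k = rq. Then every equality case for (k, G) has one of the following two forms: either (x, y) ↦ χ(x) f(y) with χ a character of ℤ/qℤ and f : ℤ/pℤ → ℂ satisfying |supp(f)| = r and |supp(f̂)| = p - r + 1; or (x, y) ↦ δ_b(x) f(y) with b ∈ ℤ/qℤ, δ_b the indicator function of {b}, and f : ℤ/pℤ → ℂ satisfying |supp(f)| = k and |supp(f̂)| = p - k + 1. -/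
open Function

open Finset Polynomial
open scoped ZMod

/-- A nonzero polynomial of degree less than the characteristic that vanishes at `1` to order `n`
has more than `n` nonzero coefficients. -/
lemma lt_card_support_of_X_sub_one_pow_dvd {k : Type*} [Field k] (p : ℕ) [CharP k p] (n : ℕ) :
    ∀ P : k[X], P ≠ 0 → P.natDegree < p → (X - 1) ^ n ∣ P → n < #P.support := by
  induction n with
  | zero => intro P hP _ _; simpa [Finset.card_pos] using hP
  | succ n ih =>
    intro P hP hdeg hdvd
    set Q : k[X] := X * derivative P - C (P.natDegree : k) * P with hQ
    have hcoeff (i : ℕ) : Q.coeff i = ((i : k) - P.natDegree) * P.coeff i := by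
      cases i with
      | zero => simp [hQ]
      | succ i => simp [hQ, coeff_X_mul, coeff_derivative]; ring
    have hsupp : Q.support = P.support.erase P.natDegree := by
      ext i
      simp only [mem_support_iff, hcoeff, Finset.mem_erase, mul_ne_zero_iff, and_congr_left_iff]
      intro hi
      have hip : i < p := (le_natDegree_of_ne_zero hi).trans_lt hdeg
      rw [sub_ne_zero, Ne, not_iff_not]
      refine ⟨fun h => ?_, fun h => h ▸ rfl⟩
      rw [CharP.natCast_eq_natCast k p] at h
      exact Nat.ModEq.eq_of_lt_of_lt h hip hdeg
    have hcard : #Q.support + 1 = #P.support := by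
      rw [hsupp, Finset.card_erase_add_one (natDegree_mem_support_of_nonzero hP)]
    have hQ0 : Q ≠ 0 := by
      intro h0
      have h1 : #P.support = 1 := by rw [← hcard, h0]; simp
      obtain ⟨m, c, hc, rfl⟩ := card_support_eq_one.mp h1
      have h2 : (X - 1 : k[X]) ∣ C c * X ^ m := (dvd_pow_self _ n.succ_ne_zero).trans hdvd
      rw [← C_1, dvd_iff_isRoot] at h2
      simp [hc] at h2
    have hQdeg : Q.natDegree < p := by
      refine lt_of_le_of_lt ?_ hdeg
      refine natDegree_le_iff_coeff_eq_zero.mpr fun N hN => ?_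
      rw [hcoeff, coeff_eq_zero_of_natDegree_lt hN, mul_zero]
    have hQdvd : (X - 1) ^ n ∣ Q := by
      refine dvd_sub (Dvd.dvd.mul_left ?_ _) (Dvd.dvd.mul_left ((pow_dvd_pow _ n.le_succ).trans hdvd) _)
      simpa only [Nat.add_sub_cancel] using pow_sub_one_dvd_derivative_of_pow_dvd hdvd
    have := ih Q hQ0 hQdeg hQdvd
    omega

/-- Every prime lies in the maximal ideal of some valuation subring of `ℂ`. -/
lemma exists_valuationSubring_valuation_lt_one (l : ℕ) [Fact l.Prime] :
    ∃ O : ValuationSubring ℂ, O.valuation (l : ℂ) < 1 := by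
  let A : Subring ℂ := (Int.castRingHom ℂ).range
  have hI : Ideal.span {(l : A)} ≠ ⊤ := by
    rw [Ne, Ideal.eq_top_iff_one, Ideal.mem_span_singleton]
    rintro ⟨⟨_, m, rfl⟩, hm⟩
    have h1 : (1 : ℂ) = (l : ℂ) * (m : ℂ) := by simpa using congrArg Subtype.val hm
    have h2 : (1 : ℤ) = l * m := by exact_mod_cast h1
    exact (Nat.prime_iff_prime_int.mp (Fact.out : l.Prime)).not_isUnit (IsUnit.of_mul_eq_one _ h2.symm)
  obtain ⟨O, -, hO⟩ := Ideal.image_subset_nonunits_valuationSubring _ hI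
  exact ⟨O, hO ⟨_, Ideal.subset_span rfl, by simp⟩⟩

variable {O : ValuationSubring ℂ} {l : ℕ} [Fact l.Prime]

/-- The residue field at a prime `l` has characteristic `l`. -/
lemma charP_residueField (hO : O.valuation (l : ℂ) < 1) :
    CharP (IsLocalRing.ResidueField O) l := by
  rw [CharP.charP_iff_prime_eq_zero Fact.out, ← map_natCast (IsLocalRing.residue O),
    IsLocalRing.residue_eq_zero_iff, ValuationSubring.valuation_lt_one_iff]
  exact_mod_cast hO

lemma valuation_eq_one_of_pow_eq_one {z : ℂ} {n : ℕ} (hn : n ≠ 0) (hz : z ^ n = 1) :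
    O.valuation z = 1 := by
  rw [← pow_eq_one_iff_of_nonneg zero_le hn, ← map_pow, hz, map_one]

/-- The `l`-th roots of unity reduce to `1` at a prime above `l`. -/
lemma residue_eq_one_of_pow_eq_one (hO : O.valuation (l : ℂ) < 1) {z : O} (hz : z ^ l = 1) :
    IsLocalRing.residue O z = 1 := by
  have := charP_residueField hO
  rw [← sub_eq_zero, ← pow_eq_zero_iff (NeZero.ne l), sub_pow_char, ← map_pow, hz]
  simp

lemma stdAddChar_pow (n : ℕ) [NeZero n] (a : ZMod n) : ZMod.stdAddChar a ^ n = 1 := by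
  rw [← AddChar.map_nsmul_eq_pow]
  simp

lemma valuation_stdAddChar (n : ℕ) [NeZero n] (a : ZMod n) :
    O.valuation (ZMod.stdAddChar a) = 1 :=
  valuation_eq_one_of_pow_eq_one (NeZero.ne n) (stdAddChar_pow n a)

lemma valuation_stdAddChar_sub_one_lt_one (hO : O.valuation (l : ℂ) < 1) (a : ZMod l) :
    O.valuation (ZMod.stdAddChar a - 1) < 1 := by
  have hmem : ZMod.stdAddChar a ∈ O :=
    (O.valuation_le_one_iff _).mp (valuation_stdAddChar l a).le
  have h := residue_eq_one_of_pow_eq_one hO (z := ⟨_, hmem⟩) (Subtype.ext (stdAddChar_pow l a))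
  rw [← sub_eq_zero, ← map_one (IsLocalRing.residue O), ← map_sub,
    IsLocalRing.residue_eq_zero_iff, ValuationSubring.valuation_lt_one_iff] at h
  exact h

/-- The uncertainty principle on `ℤ/pℤ` (Biró, Meshulam, Tao). -/
theorem add_one_le_card_support_add_card_support_dft (p : ℕ) [Fact p.Prime] (f : ZMod p → ℂ)
    (hf : f ≠ 0) : p + 1 ≤ #{x | f x ≠ 0} + #{y | 𝓕 f y ≠ 0} := by
  obtain ⟨O, hO⟩ := exists_valuationSubring_valuation_lt_one p
  have := charP_residueField hO
  obtain ⟨x₀, -, hx₀⟩ := exists_max_image univ (fun x => O.valuation (f x)) univ_nonempty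
  have hfx₀ : f x₀ ≠ 0 := by
    intro h0
    refine hf (funext fun x => ?_)
    simpa [h0] using hx₀ x (mem_univ x)
  have hmem (x : ZMod p) : f x / f x₀ ∈ O := by
    rw [← O.valuation_le_one_iff, map_div₀]
    exact div_le_one_of_le₀ (hx₀ x (mem_univ x)) zero_le
  have hζ (b : ZMod p) : ZMod.stdAddChar (-b) ∈ O :=
    (O.valuation_le_one_iff _).mp (valuation_stdAddChar p (-b)).le
  let P : O[X] := ∑ x : ZMod p, C ⟨f x / f x₀, hmem x⟩ * X ^ x.val
  let ζ (b : ZMod p) : O := ⟨_, hζ b⟩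
  have hcoeff (x : ZMod p) : P.coeff x.val = ⟨f x / f x₀, hmem x⟩ := by
    simp [P, coeff_X_pow, (ZMod.val_injective p).eq_iff]
  have hdegP : P.natDegree < p := by
    refine (natDegree_sum_le_of_forall_le (n := p - 1) _ _ fun x _ => ?_).trans_lt
      (Nat.sub_one_lt (NeZero.ne p))
    exact (natDegree_C_mul_X_pow_le _ _).trans (Nat.le_sub_one_of_lt (ZMod.val_lt x))
  have hroot (b : ZMod p) (hb : 𝓕 f b = 0) : P.eval (ζ b) = 0 := by
    refine Subtype.ext ?_
    have h1 (x : ZMod p) : ZMod.stdAddChar (-b) ^ x.val = ZMod.stdAddChar (-(x * b)) := by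
      rw [← AddChar.map_nsmul_eq_pow, nsmul_eq_mul, ZMod.natCast_zmod_val, mul_neg]
    have h2 : (∑ x : ZMod p, ZMod.stdAddChar (-(x * b)) * f x) / f x₀ = 0 := by
      rw [ZMod.dft_apply] at hb
      simpa using Or.inl hb
    rw [Finset.sum_div] at h2
    simp only [P, ζ, eval_finsetSum, eval_mul, eval_C, eval_pow, eval_X]
    push_cast
    rw [← h2]
    refine sum_congr rfl fun x _ => ?_
    rw [h1]
    ring
  have hζinj : Injective ζ := fun a b h => by
    have h1 : ZMod.stdAddChar (-a) = ZMod.stdAddChar (-b) :=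
      congrArg (fun z : O => (z : ℂ)) h
    exact neg_injective (ZMod.injective_stdAddChar h1)
  let Z : Finset (ZMod p) := {y | 𝓕 f y = 0}
  let π := IsLocalRing.residue O
  have hx₀1 : P.coeff x₀.val = 1 := by
    rw [hcoeff]
    exact Subtype.ext (div_self hfx₀)
  have hP0 : P ≠ 0 := by
    intro h0
    simp [h0] at hx₀1
  have hdvd : ∏ b ∈ Z, (X - C (ζ b)) ∣ P := by
    have h1 : (Z.image ζ).val ≤ P.roots := by
      rw [Multiset.le_iff_subset (Z.image ζ).nodup]
      intro z hz
      obtain ⟨b, hb, rfl⟩ := Finset.mem_image.mp hz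
      exact (mem_roots hP0).mpr (hroot b (Finset.mem_filter.mp hb).2)
    have h2 := (Multiset.prod_X_sub_C_dvd_iff_le_roots hP0 _).mpr h1
    have h3 : ∏ z ∈ Z.image ζ, (X - C z) = ∏ b ∈ Z, (X - C (ζ b)) :=
      prod_image hζinj.injOn
    rw [← h3]
    exact h2
  have hlt : #Z < #(P.map π).support := by
    refine lt_card_support_of_X_sub_one_pow_dvd p _ _ ?_ ?_ ?_
    · intro h0
      have := congrArg (coeff · x₀.val) h0
      simp [hx₀1] at this
    · exact natDegree_map_le.trans_lt hdegP
    · have := Polynomial.map_dvd π hdvd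
      have hπ (b : ZMod p) : π (ζ b) = 1 :=
        residue_eq_one_of_pow_eq_one hO (Subtype.ext (stdAddChar_pow p (-b)))
      simpa [Polynomial.map_prod, hπ] using this
  have hle : #(P.map π).support ≤ #{x | f x ≠ 0} := by
    refine (card_le_card fun i hi => ?_).trans (card_image_le (f := ZMod.val))
    have hip : i < p := (le_natDegree_of_mem_supp i hi).trans_lt
      (natDegree_map_le.trans_lt hdegP)
    refine Finset.mem_image.mpr ⟨(i : ZMod p), ?_, ZMod.val_natCast_of_lt hip⟩
    rw [mem_support_iff, coeff_map] at hi
    simp only [Finset.mem_filter, Finset.mem_univ, true_and]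
    intro h0
    refine hi ?_
    have h1 := hcoeff (i : ZMod p)
    rw [ZMod.val_natCast_of_lt hip] at h1
    rw [h1]
    convert map_zero π
    simp [h0]
  have hsum : #Z + #{y | 𝓕 f y ≠ 0} = p := by
    have := card_filter_add_card_filter_not (s := univ) (fun y => 𝓕 f y = 0)
    simpa [ZMod.card] using this
  omega

section TwoDimensional

variable {p q : ℕ} [NeZero p] [NeZero q]

/-- The Fourier transform on `ℤ/qℤ × ℤ/pℤ`, with the dual group identified with the group. -/
noncomputable def prodDFT (F : ZMod q × ZMod p → ℂ) : ZMod q × ZMod p → ℂ :=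
  fun a => 𝓕 (fun x => 𝓕 (fun y => F (x, y)) a.2) a.1

lemma dft_dft_comm (G : ZMod q → ZMod p → ℂ) (a : ZMod q) (b : ZMod p) :
    𝓕 (fun y => 𝓕 (fun x => G x y) a) b = 𝓕 (fun x => 𝓕 (G x) b) a := by
  simp only [ZMod.dft_apply, smul_eq_mul, mul_sum]
  rw [sum_comm]
  exact sum_congr rfl fun x _ => sum_congr rfl fun y _ => by ring

lemma prodDFT_prodDFT (F : ZMod q × ZMod p → ℂ) (x : ZMod q) (y : ZMod p) :
    prodDFT (prodDFT F) (x, y) = q * p * F (-x, -y) := by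
  simp only [prodDFT, dft_dft_comm (fun x => 𝓕 fun y => F (x, y)), ZMod.dft_dft, smul_eq_mul]
  ring

lemma prodDFT_ne_zero {F : ZMod q × ZMod p → ℂ} (hF : F ≠ 0) : prodDFT F ≠ 0 := by
  intro h0
  refine hF (funext fun ⟨x, y⟩ => ?_)
  have h := prodDFT_prodDFT F (-x) (-y)
  rw [h0] at h
  have h1 : prodDFT (0 : ZMod q × ZMod p → ℂ) (-x, -y) = 0 := by simp [prodDFT, ZMod.dft_apply]
  rw [h1, neg_neg, neg_neg] at h
  simpa [NeZero.ne] using h.symm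

lemma prodDFT_eq_sum (F : ZMod q × ZMod p → ℂ) (a : ZMod q × ZMod p) :
    prodDFT F a = ∑ x : ZMod q × ZMod p,
      F x * (ZMod.stdAddChar (-(x.1 * a.1)) * ZMod.stdAddChar (-(x.2 * a.2))) := by
  simp only [prodDFT, ZMod.dft_apply, smul_eq_mul, mul_sum, Fintype.sum_prod_type]
  exact sum_congr rfl fun x _ => sum_congr rfl fun y _ => by ring

/-- The character of `ℤ/qℤ × ℤ/pℤ` attached to a pair. -/
noncomputable def pairChar (a : ZMod q × ZMod p) : AddChar (ZMod q × ZMod p) ℂ where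
  toFun x := ZMod.stdAddChar (x.1 * a.1) * ZMod.stdAddChar (x.2 * a.2)
  map_zero_eq_one' := by simp
  map_add_eq_mul' x y := by
    simp only [Prod.fst_add, Prod.snd_add, add_mul, AddChar.map_add_eq_mul]
    ring

lemma pairChar_apply (a x : ZMod q × ZMod p) :
    pairChar a x = ZMod.stdAddChar (x.1 * a.1) * ZMod.stdAddChar (x.2 * a.2) := rfl

lemma pairChar_bijective : Bijective (pairChar (p := p) (q := q)) := by
  rw [Fintype.bijective_iff_injective_and_card, AddChar.card_eq]
  refine ⟨fun a b h => Prod.ext ?_ ?_, rfl⟩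
  · simpa [pairChar_apply, ZMod.injective_stdAddChar.eq_iff] using DFunLike.congr_fun h (1, 0)
  · simpa [pairChar_apply, ZMod.injective_stdAddChar.eq_iff] using DFunLike.congr_fun h (0, 1)

lemma ncard_support_dft (F : ZMod q × ZMod p → ℂ) :
    (support (dft (ZMod q × ZMod p) F)).ncard = (support (prodDFT F)).ncard := by
  have h : prodDFT F = dft (ZMod q × ZMod p) F ∘ pairChar := by
    ext a
    simp [prodDFT_eq_sum, dft, pairChar_apply]
  rw [h, support_comp_eq_preimage,
    Set.ncard_preimage_of_injective_subset_range pairChar_bijective.1]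
  simp [pairChar_bijective.2.range_eq]

lemma zdft_eq_dft_s13 (f : ZMod p → ℂ) : zdft p f = 𝓕 f := by
  ext y
  simp only [zdft, ZMod.dft_apply, smul_eq_mul]
  refine sum_congr rfl fun x _ => ?_
  have h : -(x * y) = ((-(x.val * y.val : ℕ) : ℤ) : ZMod p) := by simp
  rw [h, ZMod.stdAddChar_coe, mul_comm]
  congr 2
  push_cast
  ring

lemma ncard_support_eq_card {α : Type*} [Fintype α] (f : α → ℂ) :
    (support f).ncard = #{x | f x ≠ 0} := by
  rw [← Set.ncard_coe_finset]
  congr 1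
  ext
  simp

lemma ncard_support_eq_sum_row {α β : Type*} [Fintype α] [Fintype β] (F : α × β → ℂ) :
    (support F).ncard = ∑ x, #{y | F (x, y) ≠ 0} := by
  simp only [ncard_support_eq_card, card_filter, Fintype.sum_prod_type]

lemma ncard_support_eq_sum_col {α β : Type*} [Fintype α] [Fintype β] (F : α × β → ℂ) :
    (support F).ncard = ∑ y, #{x | F (x, y) ≠ 0} := by
  simp only [ncard_support_eq_card, card_filter, Fintype.sum_prod_type_right]

lemma ncard_support_prodDFT_prodDFT (F : ZMod q × ZMod p → ℂ) :
    (support (prodDFT (prodDFT F))).ncard = (support F).ncard := by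
  have h : support (prodDFT (prodDFT F)) = Neg.neg ⁻¹' support F := by
    ext ⟨x, y⟩
    simp [prodDFT_prodDFT, NeZero.ne]
  rw [h, Set.ncard_preimage_of_injective_subset_range neg_injective]
  simp [neg_surjective.range_eq]

end TwoDimensional

section Exceptional

variable {p q r : ℕ} [Fact p.Prime] [Fact q.Prime]

/-- There is a nonzero function on `ℤ/qℤ × ℤ/pℤ` with support and spectrum of size at most
`r * q`. -/
lemma theta_le_s13 (hr : (q + 1) * r = p + 1) : theta (ZMod q × ZMod p) (r * q) ≤ r * q := by
  have hq : 1 < q := (Fact.out : q.Prime).one_lt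
  have hr0 : 0 < r := by
    rcases Nat.eq_zero_or_pos r with rfl | h
    · simp at hr
    · exact h
  have hrp : r ≤ p := by nlinarith
  obtain ⟨S, hS⟩ : ∃ S : Finset (ZMod p), #S = r := by
    obtain ⟨S, -, hS⟩ := exists_subset_card_eq (s := (univ : Finset (ZMod p)))
      (by simpa [ZMod.card] using hrp)
    exact ⟨S, hS⟩
  obtain ⟨B, hB⟩ : ∃ B : Finset (ZMod p), #B = r - 1 := by
    obtain ⟨B, -, hB⟩ := exists_subset_card_eq (s := (univ : Finset (ZMod p))) (n := r - 1)
      (by simp [ZMod.card]; omega)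
    exact ⟨B, hB⟩
  let L : (ZMod p → ℂ) →ₗ[ℂ] ((Sᶜ : Finset (ZMod p)) → ℂ) × (B → ℂ) :=
    (LinearMap.funLeft ℂ ℂ Subtype.val).prod
      ((LinearMap.funLeft ℂ ℂ Subtype.val).comp (ZMod.dft (E := ℂ)).toLinearMap)
  have hL : LinearMap.ker L ≠ ⊥ := by
    refine LinearMap.ker_ne_bot_of_finrank_lt ?_
    simp only [Module.finrank_prod, Module.finrank_fintype_fun_eq_card, Fintype.card_coe,
      card_compl, ZMod.card, hS, hB]
    omega
  obtain ⟨f, hfL, hf⟩ := (Submodule.ne_bot_iff _).mp hL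
  have hfS (x : ZMod p) (hx : f x ≠ 0) : x ∈ S := by
    by_contra hxS
    exact hx (congrFun (congrArg Prod.fst hfL) ⟨x, mem_compl.mpr hxS⟩)
  have hfB (y : ZMod p) (hy : 𝓕 f y ≠ 0) : y ∉ B := fun hyB =>
    hy (congrFun (congrArg Prod.snd hfL) ⟨y, hyB⟩)
  let F : ZMod q × ZMod p → ℂ := fun x => f x.2
  have hFdft (a : ZMod q × ZMod p) (ha : prodDFT F a ≠ 0) : a.1 = 0 ∧ 𝓕 f a.2 ≠ 0 := by
    have h : prodDFT F a = (∑ x : ZMod q, ZMod.stdAddChar (x * -a.1)) * 𝓕 f a.2 := by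
      simp [prodDFT, F, ZMod.dft_apply (N := q), sum_mul]
    rw [h, AddChar.sum_mulShift _ (ZMod.isPrimitive_stdAddChar q)] at ha
    simpa [NeZero.ne] using ha
  have hF0 : F ≠ 0 := fun h => hf (funext fun y => congrFun h (0, y))
  have h1 : (support F).ncard ≤ r * q := by
    rw [ncard_support_eq_sum_row]
    refine (sum_le_card_nsmul _ _ r fun x _ => ?_).trans_eq ?_
    · rw [← hS]
      exact card_le_card fun y hy => hfS y (Finset.mem_filter.mp hy).2
    · simp [ZMod.card, mul_comm]
  have h2 : (support (dft (ZMod q × ZMod p) F)).ncard ≤ r * q := by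
    rw [ncard_support_dft]
    calc (support (prodDFT F)).ncard
        ≤ ((({0} : Finset (ZMod q)) ×ˢ Bᶜ : Finset _) : Set (ZMod q × ZMod p)).ncard := by
          refine Set.ncard_le_ncard (fun a ha => ?_) (Set.toFinite _)
          obtain ⟨ha1, ha2⟩ := hFdft a ha
          exact Finset.mem_coe.mpr (Finset.mem_product.mpr
            ⟨Finset.mem_singleton.mpr ha1, mem_compl.mpr (hfB _ ha2)⟩)
      _ = p - (r - 1) := by
          rw [Set.ncard_coe_finset, card_product, card_compl, ZMod.card, hB, card_singleton,
            one_mul]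
      _ ≤ r * q := by
          have : r * q + r = p + 1 := by rw [← hr]; ring
          omega
  exact le_trans (Nat.sInf_le ⟨F, hF0, h1, rfl⟩) h2

/-- A function with support and spectrum of size at most `r * q` is supported on a single row, or
its spectrum meets every column at most once. -/
lemma rows_or_columns (hr : (q + 1) * r = p + 1) {F : ZMod q × ZMod p → ℂ} (hF : F ≠ 0)
    (hsupp : (support F).ncard ≤ r * q) (hspec : (support (prodDFT F)).ncard ≤ r * q) :
    (∃ x₀, ∀ x y, F (x, y) ≠ 0 → x = x₀) ∨ ∀ b, #{a | prodDFT F (a, b) ≠ 0} ≤ 1 := by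
  classical
  rw [ncard_support_eq_sum_row] at hsupp
  rw [ncard_support_eq_sum_col] at hspec
  have hr0 : 0 < r := by
    rcases Nat.eq_zero_or_pos r with rfl | h
    · simp at hr
    · exact h
  let H (x : ZMod q) : ZMod p → ℂ := 𝓕 fun y => F (x, y)
  let X : Finset (ZMod q) := {x | ∃ y, F (x, y) ≠ 0}
  let B : Finset (ZMod p) := {b | ∃ x, H x b ≠ 0}
  have hHX (x : ZMod q) (b : ZMod p) (h : H x b ≠ 0) : x ∈ X := by
    by_contra hx
    have h0 : (fun y => F (x, y)) = 0 := funext fun y => by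
      by_contra hy
      exact hx (Finset.mem_filter.mpr ⟨Finset.mem_univ _, y, hy⟩)
    exact h (by simp [H, h0])
  have hB (b : ZMod p) (hb : b ∈ B) : q + 1 ≤ #{a | prodDFT F (a, b) ≠ 0} + #X := by
    obtain ⟨x, hx⟩ := (Finset.mem_filter.mp hb).2
    have h := add_one_le_card_support_add_card_support_dft q (fun x => H x b)
      (fun h0 => hx (congrFun h0 x))
    have h2 : #{x | H x b ≠ 0} ≤ #X :=
      card_le_card fun x hx => hHX x b (Finset.mem_filter.mp hx).2
    change q + 1 ≤ #{a | 𝓕 (fun x => H x b) a ≠ 0} + #X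
    omega
  have hX (x : ZMod q) (hx : x ∈ X) : p + 1 ≤ #{y | F (x, y) ≠ 0} + #B := by
    obtain ⟨y, hy⟩ := (Finset.mem_filter.mp hx).2
    have h := add_one_le_card_support_add_card_support_dft p (fun y => F (x, y))
      (fun h0 => hy (congrFun h0 y))
    refine h.trans (Nat.add_le_add_left (card_le_card fun b hb => ?_) _)
    exact Finset.mem_filter.mpr ⟨Finset.mem_univ _, x, (Finset.mem_filter.mp hb).2⟩
  have hsumB : #B * (q + 1) ≤ r * q + #B * #X := by
    have h := card_nsmul_le_sum B _ _ hB
    rw [sum_add_distrib, sum_const, smul_eq_mul, smul_eq_mul] at h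
    exact h.trans (Nat.add_le_add_right
      ((sum_le_sum_of_subset (subset_univ B)).trans hspec) _)
  have hsumX : #X * (p + 1) ≤ r * q + #X * #B := by
    have h := card_nsmul_le_sum X _ _ hX
    rw [sum_add_distrib, sum_const, smul_eq_mul, smul_eq_mul] at h
    exact h.trans (Nat.add_le_add_right
      ((sum_le_sum_of_subset (subset_univ X)).trans hsupp) _)
  have hX1 : 1 ≤ #X := by
    obtain ⟨⟨x, y⟩, hxy⟩ := Function.ne_iff.mp hF
    exact card_pos.mpr ⟨x, Finset.mem_filter.mpr ⟨Finset.mem_univ _, y, hxy⟩⟩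
  have hXq : #X ≤ q := by simpa [ZMod.card] using card_le_univ X
  have hcase : #X = 1 ∨ #X = q := by
    by_contra! hne
    have h1 : 1 < #X := by omega
    have h2 : #X < q := by omega
    rw [← hr] at hsumX
    generalize #X = s at *
    generalize #B = m at *
    obtain ⟨t, rfl⟩ : ∃ t, s = t + 2 := ⟨s - 2, by omega⟩
    obtain ⟨u, rfl⟩ : ∃ u, q = t + u + 3 := ⟨q - (t + 3), by omega⟩
    have h3 : m * (u + 2) ≤ r * (t + u + 3) := by nlinarith
    have h4 := Nat.mul_le_mul_right (u + 2) hsumX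
    have h5 := Nat.mul_le_mul_left (t + 2) h3
    have h6 : 0 < r * ((t + u + 4) * (u * t + u + t + 1)) := by positivity
    nlinarith
  rcases hcase with h1 | hq
  · left
    obtain ⟨x₀, hx₀⟩ := card_eq_one.mp h1
    refine ⟨x₀, fun x y hxy => ?_⟩
    rw [← Finset.mem_singleton, ← hx₀]
    exact Finset.mem_filter.mpr ⟨Finset.mem_univ _, y, hxy⟩
  · right
    have hBcard : r * q ≤ #B := by
      rw [← hr, hq] at hsumX
      have : 0 < q := (Fact.out : q.Prime).pos
      nlinarith
    intro b
    by_contra! hb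
    have hbB : b ∈ B := by
      by_contra hbB
      have h0 : (fun x => H x b) = 0 := funext fun x => by
        by_contra hx
        exact hbB (Finset.mem_filter.mpr ⟨Finset.mem_univ _, x, hx⟩)
      have h1 (a : ZMod q) : prodDFT F (a, b) = 0 := by
        change 𝓕 (fun x => H x b) a = 0
        simp [h0]
      simp [h1] at hb
    have hlt : ∑ _b ∈ B, 1 < ∑ b ∈ B, #{a | prodDFT F (a, b) ≠ 0} :=
      sum_lt_sum (fun b hb => by have := hB b hb; omega) ⟨b, hbB, hb⟩
    have hle := (sum_le_sum_of_subset (f := fun b => #{a | prodDFT F (a, b) ≠ 0})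
      (subset_univ B)).trans hspec
    rw [← card_eq_sum_ones] at hlt
    omega

/-- A nonzero function on `ℤ/qℤ × ℤ/pℤ` and its Fourier transform cannot both be supported on
graphs of functions from `ℤ/pℤ` to `ℤ/qℤ`. -/
lemma not_columns_card_le_one_of_prodDFT (hqp : q < p) {F : ZMod q × ZMod p → ℂ} (hF : F ≠ 0)
    (hsupp : ∀ y, #{x | F (x, y) ≠ 0} ≤ 1) (hspec : ∀ b, #{a | prodDFT F (a, b) ≠ 0} ≤ 1) :
    False := by
  classical
  obtain ⟨O, hO⟩ := exists_valuationSubring_valuation_lt_one q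
  let v := O.valuation
  have hvint (m : ℤ) : v (m : ℂ) ≤ 1 := (O.valuation_le_one_iff _).mpr (intCast_mem O m)
  have hvp : v (p : ℂ) = 1 := by
    refine le_antisymm (by exact_mod_cast hvint p) (not_lt.mp fun hlt => ?_)
    obtain ⟨m, n, hmn⟩ := Nat.isCoprime_iff_coprime.mpr
      ((Nat.coprime_primes Fact.out Fact.out).mpr hqp.ne' : p.Coprime q)
    have h1 : (m : ℂ) * p + n * q = 1 := by exact_mod_cast hmn
    refine lt_irrefl (1 : O.ValueGroup) ?_
    conv_lhs => rw [← map_one v, ← h1]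
    refine v.map_add_lt ?_ ?_
    · rw [map_mul]
      exact (mul_le_of_le_one_left' (hvint m)).trans_lt hlt
    · rw [map_mul]
      exact (mul_le_of_le_one_left' (hvint n)).trans_lt hO
  let H (x : ZMod q) : ZMod p → ℂ := 𝓕 fun y => F (x, y)
  have hinv (x : ZMod q) (y : ZMod p) :
      (p : ℂ) * F (x, y) = ∑ b : ZMod p, ZMod.stdAddChar (b * y) * H x b := by
    have h := congrFun (ZMod.dft_dft fun y => F (x, y)) (-y)
    rw [ZMod.dft_apply] at h
    simpa [H] using h.symm
  obtain ⟨⟨x₀, b₀⟩, -, hmax⟩ :=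
    exists_max_image univ (fun a : ZMod q × ZMod p => v (H a.1 a.2)) univ_nonempty
  have hM : v (H x₀ b₀) ≠ 0 := by
    intro h0
    refine hF (funext fun ⟨x, y⟩ => ?_)
    have hH (b : ZMod p) : H x b = 0 := by
      simpa [h0] using hmax (x, b) (Finset.mem_univ _)
    have := hinv x y
    simpa [hH, NeZero.ne] using this
  have hdiff (x x' : ZMod q) (b : ZMod p) : v (H x b - H x' b) < v (H x₀ b₀) := by
    obtain ⟨a, ha⟩ : ∃ a, ∀ a', prodDFT F (a', b) ≠ 0 → a' = a := by
      obtain ⟨a, ha⟩ := card_le_one_iff_subset_singleton.mp (hspec b)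
      exact ⟨a, fun a' h => Finset.mem_singleton.mp (ha (by simpa using h))⟩
    have hcol (x : ZMod q) :
        (q : ℂ) * H x b = ZMod.stdAddChar (a * x) * prodDFT F (a, b) := by
      have h := congrFun (ZMod.dft_dft fun x => H x b) (-x)
      rw [ZMod.dft_apply, Fintype.sum_eq_single a] at h
      · simpa [H, prodDFT] using h.symm
      · intro a' ha'
        have : prodDFT F (a', b) = 0 := not_imp_comm.mp (ha a') ha'
        rw [show 𝓕 (fun x => H x b) a' = 0 from this, smul_zero]
    have hrow : H x b = ZMod.stdAddChar (a * (x - x')) * H x' b := by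
      refine mul_left_cancel₀ (NeZero.ne (q : ℂ)) ?_
      rw [mul_left_comm, hcol, hcol, ← mul_assoc, ← AddChar.map_add_eq_mul]
      congr 2
      ring
    have h1 : H x b - H x' b = (ZMod.stdAddChar (a * (x - x')) - 1) * H x' b := by
      rw [hrow]
      ring
    rw [h1, map_mul]
    calc v (ZMod.stdAddChar (a * (x - x')) - 1) * v (H x' b)
        ≤ v (ZMod.stdAddChar (a * (x - x')) - 1) * v (H x₀ b₀) :=
          mul_le_mul_right (hmax (x', b) (Finset.mem_univ _)) _
      _ < v (H x₀ b₀) :=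
          mul_lt_of_lt_one_left (zero_lt_iff.mpr hM)
            (valuation_stdAddChar_sub_one_lt_one hO _)
  have hFlt (x : ZMod q) (y : ZMod p) : v (F (x, y)) < v (H x₀ b₀) := by
    obtain ⟨x', hx'⟩ := exists_ne x
    by_cases h0 : F (x, y) = 0
    · rw [h0, map_zero]
      exact zero_lt_iff.mpr hM
    have h1 : F (x', y) = 0 := by
      by_contra h1
      exact hx' (card_le_one.mp (hsupp y) x' (by simpa using h1) x (by simpa using h0))
    have h2 : (p : ℂ) * F (x, y) = ∑ b : ZMod p, ZMod.stdAddChar (b * y) * (H x b - H x' b) := by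
      have h3 := hinv x' y
      rw [h1, mul_zero] at h3
      simp only [mul_sub, sum_sub_distrib]
      rw [← h3, sub_zero, hinv]
    rw [← one_mul (v (F (x, y))), ← hvp, ← map_mul, h2]
    refine v.map_sum_lt hM fun b _ => ?_
    rw [map_mul, valuation_stdAddChar, one_mul]
    exact hdiff x x' b
  refine lt_irrefl (v (H x₀ b₀)) ?_
  conv_lhs => rw [show H x₀ b₀ = _ from ZMod.dft_apply _ _]
  refine v.map_sum_lt hM fun y _ => ?_
  rw [smul_eq_mul, map_mul, valuation_stdAddChar, one_mul]
  exact hFlt x₀ y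

/-- The uncertainty principle on `ℤ/pℤ`, in terms of `zdft`. -/
lemma add_one_le_ncard_support_add_ncard_support_zdft (f : ZMod p → ℂ) (hf : f ≠ 0) :
    p + 1 ≤ (support f).ncard + (support (zdft p f)).ncard := by
  rw [zdft_eq_dft_s13, ncard_support_eq_card, ncard_support_eq_card]
  exact add_one_le_card_support_add_card_support_dft p f hf

/-- A function supported on one row is a point mass tensored with an extremal function. -/
lemma form_of_single_row (hr : (q + 1) * r = p + 1) {F : ZMod q × ZMod p → ℂ} (hF : F ≠ 0)
    (hsupp : (support F).ncard = r * q) (hspec : (support (prodDFT F)).ncard ≤ r * q)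
    {b : ZMod q} (hb : ∀ x y, F (x, y) ≠ 0 → x = b) :
    ∃ (b : ZMod q) (f : ZMod p → ℂ),
      (support f).ncard = r * q ∧ (support (zdft p f)).ncard = p - r * q + 1 ∧
      F = fun x => (if x.1 = b then 1 else 0) * f x.2 := by
  let f : ZMod p → ℂ := fun y => F (b, y)
  have hFf : F = fun x => (if x.1 = b then 1 else 0) * f x.2 := by
    ext ⟨x, y⟩
    by_cases hx : x = b
    · simp [f, hx]
    · simpa [hx] using not_imp_comm.mp (hb x y) hx
  have hf : f ≠ 0 := fun h0 => hF (by rw [hFf, h0]; simp; rfl)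
  have hfsupp : (support f).ncard = r * q := by
    rw [← hsupp, ncard_support_eq_sum_row, Fintype.sum_eq_single b, ncard_support_eq_card]
    intro x hx
    have h0 (y : ZMod p) : F (x, y) = 0 := not_imp_comm.mp (hb x y) hx
    simp [h0]
  have hdft (a : ZMod q) (y : ZMod p) :
      prodDFT F (a, y) = ZMod.stdAddChar (-(b * a)) * zdft p f y := by
    rw [zdft_eq_dft_s13, prodDFT, ZMod.dft_apply, Fintype.sum_eq_single b]
    · rfl
    · intro x hx
      have h0 : (fun y => F (x, y)) = 0 := funext fun y => not_imp_comm.mp (hb x y) hx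
      simp [h0]
  have hne (a : ZMod q) : (ZMod.stdAddChar a : ℂ) ≠ 0 := (AddChar.val_isUnit _ _).ne_zero
  have hspec' : q * (support (zdft p f)).ncard ≤ r * q := by
    refine le_trans (le_of_eq ?_) hspec
    rw [ncard_support_eq_sum_row]
    simp [hdft, hne, ncard_support_eq_card, ZMod.card]
  have hle : (support (zdft p f)).ncard ≤ r := by
    rw [mul_comm] at hspec'
    exact Nat.le_of_mul_le_mul_right hspec' (Fact.out : q.Prime).pos
  have h := add_one_le_ncard_support_add_ncard_support_zdft f hf
  have h2 : r * q + r = p + 1 := by rw [← hr]; ring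
  have hr0 : 0 < r := Nat.pos_of_ne_zero (by rintro rfl; simp at hr)
  exact ⟨b, f, hfsupp, by omega, hFf⟩

/-- A function whose spectrum lies on one row is a character tensored with an extremal
function. -/
lemma form_of_single_row_spectrum (hr : (q + 1) * r = p + 1) {F : ZMod q × ZMod p → ℂ}
    (hF : F ≠ 0) (hsupp : (support F).ncard = r * q)
    (hspec : (support (prodDFT F)).ncard ≤ r * q)
    {a₀ : ZMod q} (ha₀ : ∀ a b, prodDFT F (a, b) ≠ 0 → a = a₀) :
    ∃ (χ : AddChar (ZMod q) ℂ) (f : ZMod p → ℂ),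
      (support f).ncard = r ∧ (support (zdft p f)).ncard = p - r + 1 ∧
      F = fun x => χ x.1 * f x.2 := by
  have hq : 0 < q := (Fact.out : q.Prime).pos
  let χ : AddChar (ZMod q) ℂ := AddChar.mulShift ZMod.stdAddChar a₀
  let f : ZMod p → ℂ := fun y => F (0, y)
  have hinv (x : ZMod q) (y : ZMod p) : (q : ℂ) * p * F (x, y) =
      χ x * 𝓕 (fun b => prodDFT F (a₀, b)) (-y) := by
    have h := prodDFT_prodDFT F (-x) (-y)
    rw [neg_neg, neg_neg, prodDFT, ZMod.dft_apply, Fintype.sum_eq_single a₀] at h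
    · rw [← h]
      simp [χ, AddChar.mulShift_apply]
    · intro a ha
      have h0 : (fun b => prodDFT F (a, b)) = 0 :=
        funext fun b => not_imp_comm.mp (ha₀ a b) ha
      simp [h0]
  have hFf : F = fun x => χ x.1 * f x.2 := by
    ext ⟨x, y⟩
    refine mul_left_cancel₀ (mul_ne_zero (NeZero.ne (q : ℂ)) (NeZero.ne (p : ℂ))) ?_
    have h0 := hinv 0 y
    rw [AddChar.map_zero_eq_one, one_mul] at h0
    rw [hinv, ← h0]
    ring
  have hf : f ≠ 0 := fun h0 => hF (by rw [hFf, h0]; simp; rfl)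
  have hχ (x : ZMod q) : χ x ≠ 0 := (AddChar.val_isUnit _ _).ne_zero
  have hfsupp : (support f).ncard = r := by
    have h : q * (support f).ncard = r * q := by
      rw [← hsupp, ncard_support_eq_sum_row]
      simp [congrFun hFf, hχ, ncard_support_eq_card, ZMod.card]
    rw [mul_comm] at h
    exact Nat.eq_of_mul_eq_mul_right hq h
  have hdft (b : ZMod p) : prodDFT F (a₀, b) = q * zdft p f b := by
    have h1 (x : ZMod q) : 𝓕 (fun y => F (x, y)) b = χ x * 𝓕 f b := by
      have hFx : (fun y => F (x, y)) = χ x • f := funext fun y => congrFun hFf (x, y)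
      rw [hFx, map_smul, Pi.smul_apply, smul_eq_mul]
    have h2 (x : ZMod q) : ZMod.stdAddChar (-(x * a₀)) * χ x = (1 : ℂ) := by
      rw [AddChar.mulShift_apply, ← AddChar.map_add_eq_mul, mul_comm a₀, neg_add_cancel,
        AddChar.map_zero_eq_one]
    rw [zdft_eq_dft_s13]
    simp [prodDFT, ZMod.dft_apply (N := q), h1, ← mul_assoc, h2, ZMod.card]
  have hspec' : (support (zdft p f)).ncard ≤ r * q := by
    refine le_trans (le_of_eq ?_) hspec
    rw [ncard_support_eq_sum_row, Fintype.sum_eq_single a₀]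
    · simp [hdft, NeZero.ne, ncard_support_eq_card]
    · intro a ha
      have h0 (b : ZMod p) : prodDFT F (a, b) = 0 := not_imp_comm.mp (ha₀ a b) ha
      simp [h0]
  have h := add_one_le_ncard_support_add_ncard_support_zdft f hf
  have h2 : r * q + r = p + 1 := by rw [← hr]; ring
  have hr0 : 0 < r := Nat.pos_of_ne_zero (by rintro rfl; simp at hr)
  have hrq : 0 < r * q := Nat.mul_pos hr0 hq
  exact ⟨χ, f, hfsupp, by omega, hFf⟩

end Exceptional

/-- For `G = ℤ/qℤ × ℤ/pℤ`, `q < p` primes with `r = (p+1)/(q+1)` an integer (written as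
`(q+1) r = p+1`) and `k = rq`, every equality case for `(k, G)` is either of the form
`(x, y) ↦ χ(x) f(y)` with `χ` a character of `ℤ/qℤ`, `|supp f| = r`, `|supp f̂| = p - r + 1`,
or of the form `(x, y) ↦ δ_b(x) f(y)` with `|supp f| = k`, `|supp f̂| = p - k + 1`. -/
theorem equality_case_exceptional (p q r : ℕ) [Fact p.Prime] [Fact q.Prime] (hqp : q < p)
    (hr : (q + 1) * r = p + 1)
    (F : ZMod q × ZMod p → ℂ) (hF : IsEqualityCase (ZMod q × ZMod p) (r * q) F) :
    (∃ (χ : AddChar (ZMod q) ℂ) (f : ZMod p → ℂ),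
      (support f).ncard = r ∧ (support (zdft p f)).ncard = p - r + 1 ∧
      F = fun x => χ x.1 * f x.2) ∨
    (∃ (b : ZMod q) (f : ZMod p → ℂ),
      (support f).ncard = r * q ∧ (support (zdft p f)).ncard = p - r * q + 1 ∧
      F = fun x => (if x.1 = b then 1 else 0) * f x.2) := by
  obtain ⟨hF0, hsupp, hspec⟩ := hF
  have hspec' : (support (prodDFT F)).ncard ≤ r * q := by
    rw [← ncard_support_dft, hspec]
    exact theta_le_s13 hr
  rcases rows_or_columns hr hF0 hsupp.le hspec' with ⟨b, hb⟩ | hcol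
  · exact Or.inr (form_of_single_row hr hF0 hsupp hspec' hb)
  have hsupp' : (support (prodDFT (prodDFT F))).ncard ≤ r * q := by
    rw [ncard_support_prodDFT_prodDFT, hsupp]
  rcases rows_or_columns hr (prodDFT_ne_zero hF0) hspec' hsupp' with ⟨a, ha⟩ | hcol'
  · exact Or.inl (form_of_single_row_spectrum hr hF0 hsupp hspec' ha)
  · refine (not_columns_card_le_one_of_prodDFT hqp (prodDFT_ne_zero hF0) hcol hcol').elim
end
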